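/- For all integers n ≥ 0, β ≥ 0 and k ≥ 1, the number 24 divides 14·5^{2k+2β-1} + 5^{2k} + 1, and p_{1,5^{2k}}(5^{2k+2β-1}·n + (14·5^{2k+2β-1} + 5^{2k} + 1)/24) ≡ 0 (mod 5^{2k+β-1}). -/

import Mathlib

open PowerSeries


/-- Number of 2-color partitions of `n` in which the second color is used only on
parts that are multiples of `ℓ`: pairs `(λ, μ)` of partitions with `|λ| + |μ| = n`
and every part of `μ` divisible by `ℓ`. -/
def p1 (ℓ n : ℕ) : ℕ :=
  ∑ a ∈ Finset.range (n + 1),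
    Fintype.card (Nat.Partition a) *
      Fintype.card {μ : Nat.Partition (n - a) // ∀ i ∈ μ.parts, ℓ ∣ i}

section Products

open PowerSeries.WithPiTopology

theorem PowerSeries.continuous_expand {R : Type*} [CommRing R] [TopologicalSpace R] (p : ℕ)
    (hp : p ≠ 0) : Continuous (expand p hp : R⟦X⟧ →ₐ[R] R⟦X⟧) := by
  rw [continuous_iff_continuousAt]
  intro f
  rw [ContinuousAt, tendsto_iff_coeff_tendsto]
  intro d
  simp only [coeff_expand]
  split_ifs
  · exact (continuous_coeff R (d / p)).continuousAt
  · exact tendsto_const_nhds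

theorem PowerSeries.continuous_rescale {R : Type*} [CommRing R] [TopologicalSpace R]
    [IsTopologicalRing R] (a : R) : Continuous (rescale a : R⟦X⟧ →+* R⟦X⟧) := by
  rw [continuous_iff_continuousAt]
  intro f
  rw [ContinuousAt, tendsto_iff_coeff_tendsto]
  intro d
  simp only [coeff_rescale]
  exact ((continuous_coeff R d).const_mul _).continuousAt

theorem HasProd.extend_multiples {M : Type*} [CommMonoid M] [TopologicalSpace M] {ℓ : ℕ}
    (hℓ : ℓ ≠ 0) {g : ℕ → M} {a : M} (h : HasProd (fun n ↦ g (n + 1)) a) :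
    HasProd (fun n ↦ if ℓ ∣ n + 1 then g ((n + 1) / ℓ) else 1) a := by
  have hpos : 0 < ℓ := Nat.pos_of_ne_zero hℓ
  have key : ∀ n, ℓ * (n + 1) - 1 + 1 = ℓ * (n + 1) := fun n ↦
    Nat.sub_add_cancel (Nat.mul_pos hpos n.succ_pos)
  have inj : Function.Injective fun n ↦ ℓ * (n + 1) - 1 := by
    intro m n hmn
    have : ℓ * (m + 1) = ℓ * (n + 1) := by rw [← key m, ← key n]; simpa using hmn
    simpa using Nat.eq_of_mul_eq_mul_left hpos this
  rw [← inj.hasProd_iff]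
  · convert h using 2 with n
    simp [key, Nat.mul_div_cancel_left _ hpos]
  · intro n hn
    rw [if_neg]
    rintro ⟨c, hc⟩
    refine hn ⟨c - 1, ?_⟩
    have : c ≠ 0 := by rintro rfl; simp at hc
    simp only [Nat.sub_add_cancel (Nat.one_le_iff_ne_zero.mpr this), ← hc]
    simp

theorem hasProd_expand_pentagonalSeries (R : Type*) [CommRing R] [TopologicalSpace R]
    (p : ℕ) (hp : p ≠ 0) :
    HasProd (fun n ↦ (1 - X ^ (p * (n + 1)) : R⟦X⟧)) (expand p hp (pentagonalSeries R)) := by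
  have := (hasProd_one_sub_X_pow R).map (expand p hp : R⟦X⟧ →ₐ[R] R⟦X⟧) (continuous_expand p hp)
  convert this using 2 with n
  simp [pow_mul]

/-- The generating function of partitions all of whose parts are multiples of `ℓ`. -/
theorem mk_card_partition_dvd_mul_expand (ℓ : ℕ) (hℓ : ℓ ≠ 0) :
    (PowerSeries.mk fun n ↦
        (Fintype.card {μ : Nat.Partition n // ∀ i ∈ μ.parts, ℓ ∣ i} : ℤ)) *
      expand ℓ hℓ (pentagonalSeries ℤ) = 1 := by
  have h1 := Nat.Partition.hasProd_powerSeriesMk_card_restricted ℤ (ℓ ∣ ·)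
  have h2 := HasProd.extend_multiples hℓ (g := fun m ↦ (1 - X ^ (ℓ * m) : ℤ⟦X⟧))
    (hasProd_expand_pentagonalSeries ℤ ℓ hℓ)
  have h3 := h1.mul h2
  have h4 : ∀ n, (Nat.Partition.restricted n (ℓ ∣ ·)).card =
      Fintype.card {μ : Nat.Partition n // ∀ i ∈ μ.parts, ℓ ∣ i} := by
    intro n
    rw [Fintype.card_subtype, Nat.Partition.restricted]
  simp only [h4] at h3
  refine h3.unique ?_
  convert hasProd_one using 2 with n
  split_ifs with h
  · rw [Nat.mul_div_cancel' h]
    simp_rw [pow_mul]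
    exact tsum_pow_mul_one_sub_of_constantCoeff_eq_zero (by simp)
  · simp

theorem prod_one_sub_pow_mul {R : Type*} [CommRing R] {v y : R}
    (h : 1 + v + v ^ 2 + v ^ 3 + v ^ 4 = 0) :
    (1 - y) * (1 - v * y) * (1 - v ^ 2 * y) * (1 - v ^ 3 * y) * (1 - v ^ 4 * y) = 1 - y ^ 5 := by
  have h5 : v ^ 5 = 1 := by linear_combination (v - 1) * h
  grind

theorem prod_rescale_one_sub_X_pow {R : Type*} [CommRing R] [IsDomain R] {ω : R}
    (hω : IsPrimitiveRoot ω 5) (n : ℕ) :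
    ∏ j ∈ Finset.range 5, rescale (ω ^ j) (1 - X ^ n : R⟦X⟧) =
      if 5 ∣ n then (1 - X ^ n) ^ 5 else 1 - X ^ (5 * n) := by
  have h0 : ∀ j : ℕ, rescale (ω ^ j) (1 - X ^ n : R⟦X⟧) = 1 - C ((ω ^ n) ^ j) * X ^ n := by
    intro j
    simp only [map_sub, map_one, map_pow, rescale_X, mul_pow, ← pow_mul, mul_comm]
  simp only [h0]
  split_ifs with h
  · obtain ⟨m, rfl⟩ := h
    simp [pow_mul, hω.pow_eq_one]
  · have hcop : Nat.Coprime n 5 := ((Nat.Prime.coprime_iff_not_dvd (by norm_num)).2 h).symm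
    have h1 : IsPrimitiveRoot (C (ω ^ n) : R⟦X⟧) 5 :=
      (hω.pow_of_coprime n hcop).map_of_injective C_injective
    have h2 := h1.geom_sum_eq_zero (by norm_num)
    simp only [Finset.sum_range_succ, Finset.sum_range_zero, pow_zero, pow_one, zero_add] at h2
    simp only [Finset.prod_range_succ, Finset.prod_range_zero, map_pow _ (ω ^ n), pow_zero, pow_one,
      one_mul]
    rw [prod_one_sub_pow_mul h2, ← pow_mul, mul_comm n 5]

theorem prod_rescale_pentagonalSeries {ω : ℂ} (hω : IsPrimitiveRoot ω 5) :
    (∏ j ∈ Finset.range 5, rescale (ω ^ j) (pentagonalSeries ℂ)) *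
        expand 25 (by norm_num) (pentagonalSeries ℂ) =
      expand 5 (by norm_num) (pentagonalSeries ℂ) ^ 6 := by
  have h1 : HasProd (fun n ↦ ∏ j ∈ Finset.range 5, rescale (ω ^ j) (1 - X ^ (n + 1) : ℂ⟦X⟧))
      (∏ j ∈ Finset.range 5, rescale (ω ^ j) (pentagonalSeries ℂ)) :=
    hasProd_prod fun j _ ↦
      (hasProd_one_sub_X_pow ℂ).map (rescale (ω ^ j)) (continuous_rescale (ω ^ j))
  simp only [prod_rescale_one_sub_X_pow hω] at h1
  have h2 := HasProd.extend_multiples (ℓ := 5) (by norm_num)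
    (g := fun m ↦ (1 - X ^ (25 * m) : ℂ⟦X⟧)) (hasProd_expand_pentagonalSeries ℂ 25 (by norm_num))
  have h5 := hasProd_expand_pentagonalSeries ℂ 5 (by norm_num)
  have h3 := HasProd.extend_multiples (ℓ := 5) (by norm_num)
    (g := fun m ↦ (1 - X ^ (5 * m) : ℂ⟦X⟧)) h5
  have h4 := h5.mul (hasProd_prod (s := Finset.range 5) fun _ _ ↦ h3)
  rw [Finset.prod_const, Finset.card_range, ← pow_succ'] at h4
  refine (h1.mul h2).unique ?_
  convert h4 using 2 with n
  rw [Finset.prod_const, Finset.card_range]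
  split_ifs with h
  · obtain ⟨m, hm⟩ := h
    rw [hm, Nat.mul_div_cancel_left _ (by norm_num), ← mul_assoc]
    ring
  · simp

end Products

section Dissection

theorem natAbs_le_pentagonal (a : ℤ) : a.natAbs ≤ pentagonal a := by
  have h := two_mul_natCast_pentagonal a
  zify
  rcases le_or_gt a 0 with h0 | h0
  · rw [abs_of_nonpos h0]
    nlinarith
  · rw [abs_of_pos h0]
    nlinarith

theorem mem_Icc_of_pentagonal_le {a : ℤ} {N : ℕ} (h : pentagonal a ≤ N) :
    a ∈ Finset.Icc (-N : ℤ) N := by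
  have := natAbs_le_pentagonal a
  rw [Finset.mem_Icc]
  omega

/-- The power series `∑ₐ f a * X ^ (a * (3 * a - 1) / 2)`, where `a` ranges over the integers. -/
noncomputable def pentagonalTheta (f : ℤ → ℤ) : ℤ⟦X⟧ :=
  PowerSeries.mk fun n ↦ ∑ a ∈ Finset.Icc (-n : ℤ) n, if pentagonal a = n then f a else 0

theorem coeff_pentagonalTheta {n N : ℕ} (h : n ≤ N) (f : ℤ → ℤ) :
    coeff n (pentagonalTheta f) =
      ∑ a ∈ Finset.Icc (-N : ℤ) N, if pentagonal a = n then f a else 0 := by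
  rw [pentagonalTheta, coeff_mk]
  refine Finset.sum_subset (Finset.Icc_subset_Icc (by omega) (by omega)) fun a _ ha ↦ ?_
  rw [if_neg]
  intro h
  exact ha (mem_Icc_of_pentagonal_le h.le)

theorem coeff_pentagonalTheta_pentagonal (f : ℤ → ℤ) (a : ℤ) :
    coeff (pentagonal a) (pentagonalTheta f) = f a := by
  rw [coeff_pentagonalTheta le_rfl, Finset.sum_eq_single a]
  · simp
  · intro b _ hb
    rw [if_neg (fun h ↦ hb (pentagonal_injective h))]
  · intro h
    exact absurd (mem_Icc_of_pentagonal_le le_rfl) h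

theorem coeff_pentagonalTheta_eq_zero (f : ℤ → ℤ) {n : ℕ}
    (h : ∀ a, pentagonal a = n → f a = 0) : coeff n (pentagonalTheta f) = 0 := by
  rw [coeff_pentagonalTheta le_rfl]
  refine Finset.sum_eq_zero fun a _ ↦ ?_
  split_ifs with h'
  · exact h a h'
  · rfl

theorem pentagonalTheta_add (f g : ℤ → ℤ) :
    pentagonalTheta (f + g) = pentagonalTheta f + pentagonalTheta g := by
  ext n
  simp only [map_add, coeff_pentagonalTheta le_rfl, ← Finset.sum_add_distrib]
  refine Finset.sum_congr rfl fun a _ ↦ ?_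
  split_ifs <;> simp

theorem pentagonalSeries_eq_pentagonalTheta :
    pentagonalSeries ℤ = pentagonalTheta fun a ↦ (Int.negOnePow a : ℤ) := by
  ext n
  by_cases h : n ∈ Set.range pentagonal
  · obtain ⟨a, rfl⟩ := h
    rw [coeff_pentagonalSeries_pentagonal, coeff_pentagonalTheta_pentagonal, Int.cast_id]
  · rw [coeff_pentagonalSeries_eq_zero _ h, coeff_pentagonalTheta_eq_zero]
    exact fun a ha ↦ absurd ⟨a, ha⟩ h

theorem coeff_pentagonalTheta_mul (f g : ℤ → ℤ) (N : ℕ) :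
    coeff N (pentagonalTheta f * pentagonalTheta g) =
      ∑ z ∈ (Finset.Icc (-N : ℤ) N ×ˢ Finset.Icc (-N : ℤ) N) with
        pentagonal z.1 + pentagonal z.2 = N, f z.1 * g z.2 := by
  rw [coeff_mul, Finset.sum_filter, Finset.sum_product]
  have : ∀ p ∈ Finset.HasAntidiagonal.antidiagonal N,
      coeff p.1 (pentagonalTheta f) * coeff p.2 (pentagonalTheta g) =
        ∑ a ∈ Finset.Icc (-N : ℤ) N, ∑ b ∈ Finset.Icc (-N : ℤ) N,
        if p = (pentagonal a, pentagonal b) then f a * g b else 0 := by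
    intro p hp
    rw [Finset.HasAntidiagonal.mem_antidiagonal] at hp
    rw [coeff_pentagonalTheta (show p.1 ≤ N by omega),
      coeff_pentagonalTheta (show p.2 ≤ N by omega), Finset.sum_mul_sum]
    refine Finset.sum_congr rfl fun a _ ↦ Finset.sum_congr rfl fun b _ ↦ ?_
    obtain ⟨i, j⟩ := p
    simp only [Prod.mk.injEq, ite_mul, mul_ite, zero_mul, mul_zero]
    grind
  rw [Finset.sum_congr rfl this, Finset.sum_comm]
  refine Finset.sum_congr rfl fun a _ ↦ ?_
  rw [Finset.sum_comm]
  refine Finset.sum_congr rfl fun b _ ↦ ?_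
  rw [Finset.sum_ite_eq']
  simp only [Finset.HasAntidiagonal.mem_antidiagonal]

/-- The part of Euler's series with summation index in the given residue classes modulo five. -/
def signOn (s : Finset ℤ) (a : ℤ) : ℤ := if a % 5 ∈ s then (Int.negOnePow a : ℤ) else 0

theorem pentagonalSeries_eq_add :
    pentagonalSeries ℤ = pentagonalTheta (signOn {0, 2}) + pentagonalTheta (signOn {1}) +
      pentagonalTheta (signOn {3, 4}) := by
  rw [pentagonalSeries_eq_pentagonalTheta, ← pentagonalTheta_add, ← pentagonalTheta_add]
  congr 1
  ext a
  have h1 := Int.emod_nonneg a (show (5 : ℤ) ≠ 0 by norm_num)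
  have h2 := Int.emod_lt_of_pos a (show (0 : ℤ) < 5 by norm_num)
  simp only [Pi.add_apply, signOn, Finset.mem_insert, Finset.mem_singleton]
  generalize a % 5 = r at h1 h2
  interval_cases r <;> simp

/-- The reflection behind the relation between the three parts of the 5-dissection: it exchanges
pairs of opposite parity and preserves the sum of the pentagonal numbers. -/
theorem sum_negOnePow_of_three_mul_sub (N : ℕ) :
    ∑ z ∈ (Finset.Icc (-N : ℤ) N ×ˢ Finset.Icc (-N : ℤ) N) with
        pentagonal z.1 + pentagonal z.2 = N,
      (if (3 * z.1 - z.2) % 5 = 2 then (Int.negOnePow (z.1 + z.2) : ℤ) else 0) = 0 := by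
  rw [← Finset.sum_filter, Finset.filter_filter]
  have key : ∀ a b : ℤ, (3 * a - b) % 5 = 2 → ∃ c d : ℤ, c = (2 - 3 * a - 4 * b) / 5 ∧
      d = (1 - 4 * a + 3 * b) / 5 ∧ 5 * c = 2 - 3 * a - 4 * b ∧ 5 * d = 1 - 4 * a + 3 * b :=
    fun a b h ↦ ⟨_, _, rfl, rfl, by omega, by omega⟩
  refine Finset.sum_involution
    (fun z _ ↦ ((2 - 3 * z.1 - 4 * z.2) / 5, (1 - 4 * z.1 + 3 * z.2) / 5)) ?_ ?_ ?_ ?_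
  · rintro ⟨a, b⟩ h
    simp only [Finset.mem_filter] at h ⊢
    obtain ⟨c, d, hc, hd, h1, h2⟩ := key a b h.2.2
    rw [← hc, ← hd]
    rcases Int.even_or_odd (a + b) with h0 | h0
    · rw [Int.negOnePow_even _ h0, Int.negOnePow_odd]
      · simp
      · rw [Int.odd_iff]; rw [Int.even_iff] at h0; omega
    · rw [Int.negOnePow_odd _ h0, Int.negOnePow_even]
      · simp
      · rw [Int.even_iff]; rw [Int.odd_iff] at h0; omega
  · rintro ⟨a, b⟩ h _ heq
    simp only [Finset.mem_filter, Prod.mk.injEq] at h heq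
    obtain ⟨c, d, hc, hd, h1, h2⟩ := key a b h.2.2
    omega
  · rintro ⟨a, b⟩ h
    simp only [Finset.mem_filter] at h
    obtain ⟨c, d, hc, hd, h1, h2⟩ := key a b h.2.2
    simp only [← hc, ← hd]
    have hsum : pentagonal c + pentagonal d = N := by
      have e1 := two_mul_natCast_pentagonal a
      have e2 := two_mul_natCast_pentagonal b
      have e3 := two_mul_natCast_pentagonal c
      have e4 := two_mul_natCast_pentagonal d
      have e5 : ((pentagonal a : ℤ) + pentagonal b) = N := by exact_mod_cast h.2.1
      zify
      have : 50 * ((pentagonal c : ℤ) + pentagonal d) =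
          50 * ((pentagonal a : ℤ) + pentagonal b) := by
        linear_combination 25 * e3 + 25 * e4 - 25 * e1 - 25 * e2 +
          (3 * (5 * c + (2 - 3 * a - 4 * b)) - 5) * h1 +
          (3 * (5 * d + (1 - 4 * a + 3 * b)) - 5) * h2
      linarith
    simp only [Finset.mem_filter, Finset.mem_product]
    refine ⟨⟨mem_Icc_of_pentagonal_le (by omega), mem_Icc_of_pentagonal_le (by omega)⟩, hsum, ?_⟩
    omega
  · rintro ⟨a, b⟩ h
    simp only [Finset.mem_filter] at h
    obtain ⟨c, d, hc, hd, h1, h2⟩ := key a b h.2.2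
    simp only [← hc, ← hd, Prod.mk.injEq]
    omega

theorem dissection_relation :
    pentagonalTheta (signOn {0, 2}) * pentagonalTheta (signOn {3, 4}) +
      pentagonalTheta (signOn {1}) ^ 2 = 0 := by
  have split02 : pentagonalTheta (signOn {0, 2}) =
      pentagonalTheta (signOn {0}) + pentagonalTheta (signOn {2}) := by
    rw [← pentagonalTheta_add]; congr 1; ext a; simp only [signOn, Pi.add_apply]; grind
  have split34 : pentagonalTheta (signOn {3, 4}) =
      pentagonalTheta (signOn {3}) + pentagonalTheta (signOn {4}) := by
    rw [← pentagonalTheta_add]; congr 1; ext a; simp only [signOn, Pi.add_apply]; grind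
  have : pentagonalTheta (signOn {0, 2}) * pentagonalTheta (signOn {3, 4}) +
      pentagonalTheta (signOn {1}) ^ 2 =
      pentagonalTheta (signOn {0}) * pentagonalTheta (signOn {3}) +
      pentagonalTheta (signOn {4}) * pentagonalTheta (signOn {0}) +
      pentagonalTheta (signOn {3}) * pentagonalTheta (signOn {2}) +
      pentagonalTheta (signOn {2}) * pentagonalTheta (signOn {4}) +
      pentagonalTheta (signOn {1}) * pentagonalTheta (signOn {1}) := by
    rw [split02, split34]; ring
  rw [this]
  ext N
  rw [map_zero]
  refine Eq.trans ?_ (sum_negOnePow_of_three_mul_sub N)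
  simp only [map_add, coeff_pentagonalTheta_mul, ← Finset.sum_add_distrib]
  refine Finset.sum_congr rfl fun z _ ↦ ?_
  obtain ⟨a, b⟩ := z
  have h1 : a % 5 = 0 ∨ a % 5 = 1 ∨ a % 5 = 2 ∨ a % 5 = 3 ∨ a % 5 = 4 := by omega
  have h2 : b % 5 = 0 ∨ b % 5 = 1 ∨ b % 5 = 2 ∨ b % 5 = 3 ∨ b % 5 = 4 := by omega
  have h3 : (3 * a - b) % 5 = (3 * (a % 5) - b % 5) % 5 := by omega
  simp only [signOn, h3, Int.negOnePow_add, Units.val_mul, Finset.mem_singleton]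
  rcases h1 with h1 | h1 | h1 | h1 | h1 <;> rcases h2 with h2 | h2 | h2 | h2 | h2 <;>
    simp [h1, h2]

theorem exists_expand_of_coeff_eq_zero {R : Type*} [CommRing R] {p : ℕ} (hp : p ≠ 0) {r : ℕ}
    (hr : r < p) (f : R⟦X⟧)
    (hf : ∀ n, n % p ≠ r → coeff n f = 0) : ∃ g : R⟦X⟧, f = X ^ r * expand p hp g := by
  refine ⟨PowerSeries.mk fun n ↦ coeff (p * n + r) f, ?_⟩
  ext n
  rw [coeff_X_pow_mul', coeff_expand]
  by_cases h : n % p = r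
  · have h0 := Nat.div_add_mod n p
    have h1 : r ≤ n := h ▸ Nat.mod_le n p
    have h2 : n - r = p * (n / p) := by omega
    rw [if_pos h1, h2, if_pos (Dvd.intro _ rfl), Nat.mul_div_cancel_left _ (Nat.pos_of_ne_zero hp),
      coeff_mk, ← h, h0]
  · rw [hf n h]
    split_ifs with h1 h2
    · obtain ⟨c, hc⟩ := h2
      have : n = r + p * c := by omega
      rw [this, Nat.add_mul_mod_self_left, Nat.mod_eq_of_lt hr] at h
      exact absurd rfl h
    · rfl
    · rfl

theorem pentagonal_mod_five (a : ℤ) : (2 * (pentagonal a : ℤ)) % 5 =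
    ((a % 5) * (3 * (a % 5) - 1)) % 5 := by
  rw [two_mul_natCast_pentagonal]
  exact (((Int.mod_modEq a 5).mul (((Int.mod_modEq a 5).mul_left 3).sub_right 1))).symm

theorem pentagonalTheta_signOn_one :
    pentagonalTheta (signOn {1}) = - (X * expand 25 (by norm_num) (pentagonalSeries ℤ)) := by
  ext n
  by_cases h : ∃ c : ℤ, pentagonal (5 * c + 1) = n
  · obtain ⟨c, rfl⟩ := h
    have h1 : pentagonal (5 * c + 1) = 25 * pentagonal (-c) + 1 := by
      have e1 := two_mul_natCast_pentagonal (5 * c + 1)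
      have e2 := two_mul_natCast_pentagonal_neg c
      zify
      linarith
    rw [coeff_pentagonalTheta_pentagonal, h1, map_neg, coeff_succ_X_mul, coeff_expand_mul,
      coeff_pentagonalSeries_pentagonal]
    have h2 : (5 * c + 1) % 5 = 1 := by omega
    simp only [signOn, h2, Finset.mem_singleton, if_true]
    rcases Int.even_or_odd c with h0 | h0
    · rw [Int.negOnePow_odd, Int.negOnePow_even]
      · simp
      · simpa using h0
      · rw [Int.odd_iff]; rw [Int.even_iff] at h0; omega
    · rw [Int.negOnePow_even, Int.negOnePow_odd]
      · simp
      · simpa using h0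
      · rw [Int.even_iff]; rw [Int.odd_iff] at h0; omega
  · rw [coeff_pentagonalTheta_eq_zero, map_neg, eq_comm, neg_eq_zero]
    · rcases n with _ | n
      · simp
      · rw [coeff_succ_X_mul, coeff_expand]
        split_ifs with h25
        · obtain ⟨m, rfl⟩ := h25
          rw [Nat.mul_div_cancel_left _ (by norm_num), coeff_pentagonalSeries_eq_zero]
          rintro ⟨c, rfl⟩
          refine h ⟨-c, ?_⟩
          have e1 := two_mul_natCast_pentagonal (5 * (-c) + 1)
          have e2 := two_mul_natCast_pentagonal c
          zify
          linarith
        · rfl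
    · intro a ha
      rw [signOn, if_neg]
      rw [Finset.mem_singleton]
      intro h1
      exact h ⟨a / 5, by rw [← ha]; congr 1; omega⟩

/-- The substitution `X ↦ X ^ 5`. -/
noncomputable abbrev expandFive : ℤ⟦X⟧ →ₐ[ℤ] ℤ⟦X⟧ := expand 5 (by norm_num)

/-- The 5-dissection of Euler's product. -/
theorem exists_dissection : ∃ A C : ℤ⟦X⟧,
    pentagonalSeries ℤ = expandFive A -
      X * expandFive (expandFive (pentagonalSeries ℤ)) +
        X ^ 2 * expandFive C ∧
    A * C + expandFive (pentagonalSeries ℤ) ^ 2 = 0 := by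
  have hA : ∀ n, n % 5 ≠ 0 → coeff n (pentagonalTheta (signOn {0, 2})) = 0 := by
    intro n hn
    refine coeff_pentagonalTheta_eq_zero _ ?_
    rintro a rfl
    have := pentagonal_mod_five a
    rw [signOn, if_neg]
    simp only [Finset.mem_insert, Finset.mem_singleton]
    rintro (h | h) <;> rw [h] at this <;> omega
  have hC : ∀ n, n % 5 ≠ 2 → coeff n (pentagonalTheta (signOn {3, 4})) = 0 := by
    intro n hn
    refine coeff_pentagonalTheta_eq_zero _ ?_
    rintro a rfl
    have := pentagonal_mod_five a
    rw [signOn, if_neg]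
    simp only [Finset.mem_insert, Finset.mem_singleton]
    rintro (h | h) <;> rw [h] at this <;> omega
  obtain ⟨A, hA⟩ := exists_expand_of_coeff_eq_zero (p := 5) (by norm_num) (by norm_num) _ hA
  obtain ⟨C, hC⟩ := exists_expand_of_coeff_eq_zero (p := 5) (by norm_num) (by norm_num) _ hC
  have hB := pentagonalTheta_signOn_one
  have h25 : expand 25 (by norm_num) (pentagonalSeries ℤ) =
      expandFive (expandFive (pentagonalSeries ℤ)) :=
    expand_mul 5 (by norm_num) 5 (by norm_num) _
  rw [pow_zero, one_mul] at hA
  rw [h25] at hB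
  refine ⟨A, C, ?_, ?_⟩
  · conv_lhs => rw [pentagonalSeries_eq_add, hA, hB, hC]
    ring
  · have h := dissection_relation
    rw [hA, hB, hC] at h
    have h' : X ^ 2 * expandFive
        (A * C + expandFive (pentagonalSeries ℤ) ^ 2) = 0 := by
      rw [map_add, map_mul, map_pow, ← h]
      ring
    have h'' := (mul_eq_zero.1 h').resolve_left (pow_ne_zero _ X_ne_zero)
    ext n
    rw [← coeff_expand_mul 5 (by norm_num), h'', map_zero, map_zero]

end Dissection

section ModularEquation

theorem prod_dissection_factors {R : Type*} [CommRing R] {w A B C : R} (x : R)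
    (h : 1 + w + w ^ 2 + w ^ 3 + w ^ 4 = 0) (hAC : A * C + B ^ 2 = 0) :
    (A - x * B + x ^ 2 * C) * (A - (w * x) * B + (w * x) ^ 2 * C) *
          (A - (w ^ 2 * x) * B + (w ^ 2 * x) ^ 2 * C) *
        (A - (w ^ 3 * x) * B + (w ^ 3 * x) ^ 2 * C) *
      (A - (w ^ 4 * x) * B + (w ^ 4 * x) ^ 2 * C) =
    A ^ 5 - 11 * x ^ 5 * B ^ 5 + x ^ 10 * C ^ 5 := by
  have h5 : w ^ 5 = 1 := by linear_combination (w - 1) * h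
  have e1 : (A - (w * x) * B + (w * x) ^ 2 * C) * (A - (w ^ 4 * x) * B + (w ^ 4 * x) ^ 2 * C) =
      A ^ 2 + x ^ 2 * B ^ 2 + x ^ 4 * C ^ 2 - (w + w ^ 4) * (A * x * B + x ^ 3 * B * C) +
        (w ^ 2 + w ^ 3) * A * x ^ 2 * C := by
    grind
  have e2 : (A - (w ^ 2 * x) * B + (w ^ 2 * x) ^ 2 * C) *
      (A - (w ^ 3 * x) * B + (w ^ 3 * x) ^ 2 * C) =
      A ^ 2 + x ^ 2 * B ^ 2 + x ^ 4 * C ^ 2 - (w ^ 2 + w ^ 3) * (A * x * B + x ^ 3 * B * C) +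
        (w + w ^ 4) * A * x ^ 2 * C := by
    grind
  grind

theorem dissection_norm_eq {R : Type*} [CommRing R] {A B C x f : R} (hAC : A * C + B ^ 2 = 0)
    (hf : f = A - x * B + x ^ 2 * C) :
    A ^ 5 - 11 * x ^ 5 * B ^ 5 + x ^ 10 * C ^ 5 =
      f ^ 5 + 5 * f ^ 4 * (x * B) + 15 * f ^ 3 * (x * B) ^ 2 + 25 * f ^ 2 * (x * B) ^ 3 +
        25 * f * (x * B) ^ 4 := by
  grind

theorem map_pentagonalSeries {R S : Type*} [CommRing R] [CommRing S] (φ : R →+* S) :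
    map φ (pentagonalSeries R) = pentagonalSeries S := by
  ext n
  rw [coeff_map]
  by_cases h : n ∈ Set.range pentagonal
  · obtain ⟨a, rfl⟩ := h
    simp [coeff_pentagonalSeries_pentagonal]
  · simp [coeff_pentagonalSeries_eq_zero _ h]

theorem rescale_expand_of_pow_eq_one {R : Type*} [CommRing R] {a : R} {p : ℕ} (hp : p ≠ 0)
    (ha : a ^ p = 1) (f : R⟦X⟧) : rescale a (expand p hp f) = expand p hp f := by
  ext n
  rw [coeff_rescale, coeff_expand]
  split_ifs with h
  · obtain ⟨m, rfl⟩ := h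
    rw [pow_mul, ha, one_pow, one_mul]
  · simp

theorem expand_five_expand_five {R : Type*} [CommRing R] (f : R⟦X⟧) :
    expand 5 (by norm_num) (expand 5 (by norm_num) f) = expand 25 (by norm_num) f :=
  (expand_mul 5 (by norm_num) 5 (by norm_num) f).symm

theorem dissection_norm_mul {A C : ℤ⟦X⟧}
    (h : pentagonalSeries ℤ = expandFive A - X * expandFive (expandFive (pentagonalSeries ℤ)) +
      X ^ 2 * expandFive C)
    (hAC : A * C + expandFive (pentagonalSeries ℤ) ^ 2 = 0) :
    (expandFive A ^ 5 - 11 * X ^ 5 * expandFive (expandFive (pentagonalSeries ℤ)) ^ 5 +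
        X ^ 10 * expandFive C ^ 5) * expandFive (expandFive (pentagonalSeries ℤ)) =
      expandFive (pentagonalSeries ℤ) ^ 6 := by
  obtain ⟨ω, hω⟩ : ∃ ω : ℂ, IsPrimitiveRoot ω 5 :=
    ⟨_, Complex.isPrimitiveRoot_exp 5 (by norm_num)⟩
  have hC : IsPrimitiveRoot (PowerSeries.C ω : ℂ⟦X⟧) 5 := hω.map_of_injective C_injective
  have hC0 := hC.geom_sum_eq_zero (by norm_num)
  simp only [Finset.sum_range_succ, Finset.sum_range_zero, pow_zero, pow_one, zero_add] at hC0
  have hN := prod_rescale_pentagonalSeries hω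
  rw [← expand_five_expand_five] at hN
  have hmap : pentagonalSeries ℂ = expand 5 (by norm_num) (map (Int.castRingHom ℂ) A) -
      X * expand 5 (by norm_num) (expand 5 (by norm_num) (pentagonalSeries ℂ)) +
      X ^ 2 * expand 5 (by norm_num) (map (Int.castRingHom ℂ) C) := by
    have := congrArg (map (Int.castRingHom ℂ)) h
    simpa [PowerSeries.map_expand, map_pentagonalSeries] using this
  have hmul : expand 5 (by norm_num) (map (Int.castRingHom ℂ) A) *
      expand 5 (by norm_num) (map (Int.castRingHom ℂ) C) +
      expand 5 (by norm_num) (expand 5 (by norm_num) (pentagonalSeries ℂ)) ^ 2 = 0 := by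
    have := congrArg (fun f ↦ expand 5 (by norm_num) (map (Int.castRingHom ℂ) f)) hAC
    simpa [PowerSeries.map_expand, map_pentagonalSeries] using this
  have hresc : ∀ j : ℕ, rescale (ω ^ j) (pentagonalSeries ℂ) =
      expand 5 (by norm_num) (map (Int.castRingHom ℂ) A) - (PowerSeries.C ω ^ j * X) *
        expand 5 (by norm_num) (expand 5 (by norm_num) (pentagonalSeries ℂ)) +
      (PowerSeries.C ω ^ j * X) ^ 2 * expand 5 (by norm_num) (map (Int.castRingHom ℂ) C) := by
    intro j
    have hj : (ω ^ j) ^ 5 = 1 := by rw [← pow_mul, mul_comm, pow_mul, hω.pow_eq_one, one_pow]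
    conv_lhs => rw [hmap]
    simp only [map_add, map_sub, map_mul, map_pow, rescale_X,
      rescale_expand_of_pow_eq_one _ hj]
  simp only [Finset.prod_range_succ, Finset.prod_range_zero, hresc, pow_zero, pow_one,
    one_mul] at hN
  rw [prod_dissection_factors X hC0 hmul] at hN
  have hinj : Function.Injective (map (Int.castRingHom ℂ)) :=
    map_injective _ (RingHom.injective_int _)
  apply hinj
  simp only [map_add, map_sub, map_mul, map_pow, map_X, PowerSeries.map_expand,
    map_pentagonalSeries, map_ofNat]
  exact hN

end ModularEquation

section Decimation

/-- The series whose coefficients are those of `f` along the progression `M * n + r`. -/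
noncomputable def decimate (M r : ℕ) : ℤ⟦X⟧ →ₗ[ℤ] ℤ⟦X⟧ where
  toFun f := PowerSeries.mk fun n ↦ coeff (M * n + r) f
  map_add' f g := by ext; simp
  map_smul' c f := by ext; simp only [coeff_mk, map_zsmul, RingHom.id_apply]

@[simp]
theorem coeff_decimate (M r n : ℕ) (f : ℤ⟦X⟧) :
    coeff n (decimate M r f) = coeff (M * n + r) f := by
  simp [decimate]

theorem decimate_decimate (M r N s : ℕ) (f : ℤ⟦X⟧) :
    decimate N s (decimate M r f) = decimate (M * N) (M * s + r) f := by
  ext n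
  simp only [coeff_decimate]
  congr 2
  ring

theorem decimate_mul_expand {M r : ℕ} (hM : M ≠ 0) (hr : r < M) (f g : ℤ⟦X⟧) :
    decimate M r (f * expand M hM g) = decimate M r f * g := by
  ext n
  rw [coeff_decimate, coeff_mul, coeff_mul]
  symm
  refine Finset.sum_of_injOn (fun z ↦ (M * z.1 + r, M * z.2)) ?_ ?_ ?_ ?_
  · rintro ⟨a, b⟩ - ⟨c, d⟩ - hz
    simpa [hM] using hz
  · rintro ⟨a, b⟩ hz
    simp only [Finset.mem_coe, Finset.HasAntidiagonal.mem_antidiagonal] at hz ⊢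
    rw [← hz]
    ring
  · rintro ⟨a, b⟩ hz hz'
    rw [Finset.HasAntidiagonal.mem_antidiagonal] at hz
    dsimp only at hz ⊢
    rw [coeff_expand]
    split_ifs with h
    · obtain ⟨c, rfl⟩ := h
      refine absurd ?_ hz'
      have hcn : c ≤ n := by
        by_contra! hlt
        have := Nat.mul_le_mul_left M (show n + 1 ≤ c by omega)
        rw [Nat.mul_add, Nat.mul_one] at this
        omega
      refine ⟨(n - c, c), ?_, ?_⟩
      · simp only [Finset.mem_coe, Finset.HasAntidiagonal.mem_antidiagonal]
        omega
      · simp only [Prod.mk.injEq, and_true]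
        rw [Nat.mul_sub]
        have := Nat.mul_le_mul_left M hcn
        omega
    · simp
  · rintro ⟨a, b⟩ -
    simp only [coeff_decimate, coeff_expand_mul]

theorem decimate_X_pow_mul {M r s : ℕ} (hM : r + s = M) (hs : 0 < s) (f : ℤ⟦X⟧) :
    decimate M 0 (X ^ s * f) = X * decimate M r f := by
  ext n
  rw [coeff_decimate, coeff_X_pow_mul']
  rcases n with _ | n
  · rw [if_neg (by omega), coeff_zero_X_mul]
  · rw [coeff_succ_X_mul, coeff_decimate, if_pos (by rw [Nat.mul_add]; omega)]
    congr 2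
    rw [Nat.mul_add]
    omega

theorem decimate_X_pow_mul_expand {M r : ℕ} (hM : M ≠ 0) (hr : r < M) (f : ℤ⟦X⟧) :
    decimate M 0 (X ^ r * expand M hM f) = if r = 0 then f else 0 := by
  rw [decimate_mul_expand hM (by omega)]
  split_ifs with h
  · have : decimate M 0 (1 : ℤ⟦X⟧) = 1 := by
      ext n
      simp [coeff_one, hM]
    rw [h, pow_zero, this, one_mul]
  · have : decimate M 0 (X ^ r : ℤ⟦X⟧) = 0 := by
      ext n
      rw [coeff_decimate, coeff_X_pow, if_neg, map_zero]
      rintro rfl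
      rcases n with _ | n
      · simp at h
      · rw [Nat.mul_add] at hr
        omega
    rw [this, zero_mul]

theorem decimate_five_mul (f g : ℤ⟦X⟧) {r : ℕ} (hr : r < 5) :
    decimate 5 r (expandFive g * f) = g * decimate 5 r f := by
  rw [mul_comm, decimate_mul_expand _ hr, mul_comm]

theorem decimate_five_sum (g₀ g₁ g₂ g₃ g₄ : ℤ⟦X⟧) :
    decimate 5 0 (expandFive g₀ + X * expandFive g₁ + X ^ 2 * expandFive g₂ +
      X ^ 3 * expandFive g₃ + X ^ 4 * expandFive g₄) = g₀ := by
  have h0 := decimate_X_pow_mul_expand (M := 5) (r := 0) (by norm_num) (by norm_num) g₀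
  have h1 := decimate_X_pow_mul_expand (M := 5) (r := 1) (by norm_num) (by norm_num) g₁
  have h2 := decimate_X_pow_mul_expand (M := 5) (r := 2) (by norm_num) (by norm_num) g₂
  have h3 := decimate_X_pow_mul_expand (M := 5) (r := 3) (by norm_num) (by norm_num) g₃
  have h4 := decimate_X_pow_mul_expand (M := 5) (r := 4) (by norm_num) (by norm_num) g₄
  simp only [pow_zero, one_mul, pow_one] at h0 h1
  simp only [map_add]
  rw [h0, h1, h2, h3, h4]
  simp

end Decimation

section EtaQuotients

theorem dissection_etaZ_pow_one {R : Type*} [CommRing R] {a b c x e : R}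
    (he : e = a - x * b + x ^ 2 * c) (hac : a * c + b ^ 2 = 0) :
    x * b * (e ^ 4 + 5 * e ^ 3 * (x * b) + 15 * e ^ 2 * (x * b) ^ 2 + 25 * e * (x * b) ^ 3) =
      -20 * x ^ 5 * b ^ 5 + x * (a ^ 4 * b + 3 * x ^ 5 * b ^ 4 * c) +
        x ^ 2 * (a ^ 3 * b ^ 2 + 2 * x ^ 5 * b ^ 3 * c ^ 2) +
        x ^ 3 * (2 * a ^ 2 * b ^ 3 + x ^ 5 * b ^ 2 * c ^ 3) +
        x ^ 4 * (3 * a * b ^ 4 + x ^ 5 * b * c ^ 4) := by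
  grind

theorem dissection_etaZ_pow_two {R : Type*} [CommRing R] {a b c x e : R}
    (he : e = a - x * b + x ^ 2 * c) (hac : a * c + b ^ 2 = 0) :
    (x * b) ^ 2 * (e ^ 3 + 5 * e ^ 2 * (x * b) + 15 * e * (x * b) ^ 2) =
      -15 * x ^ 5 * b ^ 5 + x * (5 * x ^ 5 * b ^ 4 * c) +
        x ^ 2 * (a ^ 3 * b ^ 2 + 2 * x ^ 5 * b ^ 3 * c ^ 2) +
        x ^ 3 * (2 * a ^ 2 * b ^ 3 + x ^ 5 * b ^ 2 * c ^ 3) + x ^ 4 * (5 * a * b ^ 4) := by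
  grind

theorem dissection_etaZ_pow_three {R : Type*} [CommRing R] {a b c x e : R}
    (he : e = a - x * b + x ^ 2 * c) (hac : a * c + b ^ 2 = 0) :
    (x * b) ^ 3 * (e ^ 2 + 5 * e * (x * b)) =
      -6 * x ^ 5 * b ^ 5 + x * (3 * x ^ 5 * b ^ 4 * c) + x ^ 2 * (x ^ 5 * b ^ 3 * c ^ 2) +
        x ^ 3 * (a ^ 2 * b ^ 3) + x ^ 4 * (3 * a * b ^ 4) := by
  grind

theorem dissection_etaZ_pow_four {R : Type*} [CommRing R] {a b c x e : R}
    (he : e = a - x * b + x ^ 2 * c) :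
    (x * b) ^ 4 * e = - x ^ 5 * b ^ 5 + x * (x ^ 5 * b ^ 4 * c) + x ^ 4 * (a * b ^ 4) := by
  grind

/-- The generating function of the partition numbers. -/
noncomputable def partitionSeries : ℤ⟦X⟧ :=
  PowerSeries.mk fun n ↦ (Fintype.card (Nat.Partition n) : ℤ)

theorem partitionSeries_mul_pentagonalSeries :
    partitionSeries * pentagonalSeries ℤ = 1 := by
  have h := mk_card_partition_dvd_mul_expand 1 one_ne_zero
  rw [expand_one] at h
  rw [← h, partitionSeries]
  congr 2
  ext n
  exact congrArg _ (Fintype.card_congr (Equiv.subtypeUnivEquiv (by simp)).symm)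

theorem mk_card_partition_dvd (ℓ : ℕ) (hℓ : ℓ ≠ 0) :
    (PowerSeries.mk fun n ↦
        (Fintype.card {μ : Nat.Partition n // ∀ i ∈ μ.parts, ℓ ∣ i} : ℤ)) =
      expand ℓ hℓ partitionSeries := by
  have h1 := mk_card_partition_dvd_mul_expand ℓ hℓ
  have h2 := congrArg (expand ℓ hℓ) partitionSeries_mul_pentagonalSeries
  rw [map_mul, map_one] at h2
  exact mul_right_cancel₀ (right_ne_zero_of_mul_eq_one h2) (h1.trans h2.symm)

/-- The series `X * ((X ^ 5; X ^ 5) / (X; X)) ^ 6`. -/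
noncomputable def etaS : ℤ⟦X⟧ :=
  X * expandFive (pentagonalSeries ℤ) ^ 6 * partitionSeries ^ 6

/-- The series `X * (X ^ 25; X ^ 25) / (X; X)`. -/
noncomputable def etaZ : ℤ⟦X⟧ :=
  X * expandFive (expandFive (pentagonalSeries ℤ)) * partitionSeries

theorem expandFive_partitionSeries_mul :
    expandFive partitionSeries * expandFive (pentagonalSeries ℤ) = 1 := by
  rw [← map_mul, partitionSeries_mul_pentagonalSeries, map_one]

theorem expandFive_etaS : expandFive etaS =
    X ^ 5 * expandFive (expandFive (pentagonalSeries ℤ)) ^ 6 * expandFive partitionSeries ^ 6 := by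
  simp [etaS]

theorem expandFive_etaS_mul_etaS : expandFive etaS * etaS = etaZ ^ 6 := by
  have h := expandFive_partitionSeries_mul
  rw [expandFive_etaS, etaS, etaZ]
  generalize expandFive (expandFive (pentagonalSeries ℤ)) = b
  generalize expandFive partitionSeries = p at *
  generalize expandFive (pentagonalSeries ℤ) = e at *
  calc _ = (p * e) ^ 6 * (X * b * partitionSeries) ^ 6 := by ring
    _ = _ := by rw [h, one_pow, one_mul]

theorem etaS_ne_zero : etaS ≠ 0 := by
  have h1 := right_ne_zero_of_mul_eq_one expandFive_partitionSeries_mul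
  have h2 := left_ne_zero_of_mul_eq_one partitionSeries_mul_pentagonalSeries
  exact mul_ne_zero (mul_ne_zero X_ne_zero (pow_ne_zero _ h1)) (pow_ne_zero _ h2)

theorem pentagonalSeries_norm :
    (pentagonalSeries ℤ ^ 5 +
      5 * pentagonalSeries ℤ ^ 4 * (X * expandFive (expandFive (pentagonalSeries ℤ))) +
      15 * pentagonalSeries ℤ ^ 3 * (X * expandFive (expandFive (pentagonalSeries ℤ))) ^ 2 +
      25 * pentagonalSeries ℤ ^ 2 * (X * expandFive (expandFive (pentagonalSeries ℤ))) ^ 3 +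
      25 * pentagonalSeries ℤ * (X * expandFive (expandFive (pentagonalSeries ℤ))) ^ 4) *
      (expandFive (expandFive (pentagonalSeries ℤ)) * expandFive partitionSeries ^ 6) = 1 := by
  obtain ⟨A, C, h, hAC⟩ := exists_dissection
  have hN := dissection_norm_mul h hAC
  have hAC' := congrArg expandFive hAC
  rw [map_add, map_mul, map_pow, map_zero] at hAC'
  rw [dissection_norm_eq hAC' h] at hN
  rw [← mul_assoc, hN, ← mul_pow, mul_comm, expandFive_partitionSeries_mul, one_pow]

/-- The modular equation for `etaZ`. -/
theorem etaZ_pow_five : etaZ ^ 5 =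
    expandFive etaS * (1 + 5 * etaZ + 15 * etaZ ^ 2 + 25 * etaZ ^ 3 + 25 * etaZ ^ 4) := by
  have h := pentagonalSeries_norm
  have h1 := partitionSeries_mul_pentagonalSeries
  rw [expandFive_etaS, etaZ]
  generalize expandFive (expandFive (pentagonalSeries ℤ)) = b at *
  generalize expandFive partitionSeries = p at *
  generalize pentagonalSeries ℤ = e at *
  generalize partitionSeries = q at *
  have h2 : q ^ 5 * (e ^ 5 + 5 * e ^ 4 * (X * b) + 15 * e ^ 3 * (X * b) ^ 2 +
      25 * e ^ 2 * (X * b) ^ 3 + 25 * e * (X * b) ^ 4) =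
      1 + 5 * (X * b * q) + 15 * (X * b * q) ^ 2 + 25 * (X * b * q) ^ 3 + 25 * (X * b * q) ^ 4 := by
    calc _ = (q * e) ^ 5 + 5 * (q * e) ^ 4 * (X * b * q) + 15 * (q * e) ^ 3 * (X * b * q) ^ 2 +
          25 * (q * e) ^ 2 * (X * b * q) ^ 3 + 25 * (q * e) * (X * b * q) ^ 4 := by ring
      _ = _ := by rw [h1]; ring
  rw [← h2]
  linear_combination (-(X * b * q) ^ 5) * h

theorem etaZ_pow_add_five (i : ℕ) : decimate 5 0 (etaZ ^ (i + 5)) =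
    etaS * (decimate 5 0 (etaZ ^ i) + (5 : ℤ) • decimate 5 0 (etaZ ^ (i + 1)) +
      (15 : ℤ) • decimate 5 0 (etaZ ^ (i + 2)) + (25 : ℤ) • decimate 5 0 (etaZ ^ (i + 3)) +
      (25 : ℤ) • decimate 5 0 (etaZ ^ (i + 4))) := by
  simp only [← map_smul, ← map_add]
  rw [← decimate_five_mul _ _ (by norm_num)]
  congr 1
  rw [pow_add, etaZ_pow_five]
  simp only [zsmul_eq_mul]
  push_cast
  ring

theorem decimate_etaZ_pow_of_eq_add {i : ℕ} {c : ℤ} {g₁ g₂ g₃ g₄ v w : ℤ⟦X⟧}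
    (hz : etaZ ^ i = expandFive (expandFive (pentagonalSeries ℤ) * partitionSeries ^ 6) * v +
      expandFive etaS * w)
    (hv : v = (c : ℤ⟦X⟧) * X ^ 5 * expandFive (expandFive (pentagonalSeries ℤ)) ^ 5 +
      X * expandFive g₁ + X ^ 2 * expandFive g₂ + X ^ 3 * expandFive g₃ + X ^ 4 * expandFive g₄) :
    decimate 5 0 (etaZ ^ i) = c • etaS + etaS * decimate 5 0 w := by
  have h0 : (c : ℤ⟦X⟧) * X ^ 5 * expandFive (expandFive (pentagonalSeries ℤ)) ^ 5 =
      expandFive ((c : ℤ⟦X⟧) * X * expandFive (pentagonalSeries ℤ) ^ 5) := by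
    simp
  rw [h0] at hv
  rw [hz, map_add, decimate_five_mul _ _ (by norm_num), decimate_five_mul _ _ (by norm_num), hv,
    decimate_five_sum, etaS, zsmul_eq_mul]
  ring

theorem etaZ_pow_one {b e : ℤ⟦X⟧} (hb : b = expandFive (expandFive (pentagonalSeries ℤ)))
    (he : e = pentagonalSeries ℤ) : etaZ ^ 1 =
    expandFive (expandFive (pentagonalSeries ℤ) * partitionSeries ^ 6) *
      (X * b * (e ^ 4 + 5 * e ^ 3 * (X * b) + 15 * e ^ 2 * (X * b) ^ 2 + 25 * e * (X * b) ^ 3)) +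
      expandFive etaS * 25 := by
  have hN := pentagonalSeries_norm
  have hq := partitionSeries_mul_pentagonalSeries
  rw [map_mul, map_pow, expandFive_etaS, etaZ, ← hb, ← he] at *
  generalize expandFive partitionSeries ^ 6 = p at *
  generalize partitionSeries = q at *
  have hz : X * b * q * e = X * b := by linear_combination X * b * hq
  generalize X * b * q = z at *
  rw [show X ^ 5 * b ^ 6 * p = (X * b) ^ 5 * (b * p) by ring]
  generalize b * p = r at *
  rw [← hz] at *
  linear_combination (-z ^ 1) * hN

theorem etaZ_pow_two {b e : ℤ⟦X⟧} (hb : b = expandFive (expandFive (pentagonalSeries ℤ)))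
    (he : e = pentagonalSeries ℤ) : etaZ ^ 2 =
    expandFive (expandFive (pentagonalSeries ℤ) * partitionSeries ^ 6) *
      ((X * b) ^ 2 * (e ^ 3 + 5 * e ^ 2 * (X * b) + 15 * e * (X * b) ^ 2)) +
      expandFive etaS * (25 + 25 * etaZ) := by
  have hN := pentagonalSeries_norm
  have hq := partitionSeries_mul_pentagonalSeries
  rw [map_mul, map_pow, expandFive_etaS, etaZ, ← hb, ← he] at *
  generalize expandFive partitionSeries ^ 6 = p at *
  generalize partitionSeries = q at *
  have hz : X * b * q * e = X * b := by linear_combination X * b * hq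
  generalize X * b * q = z at *
  rw [show X ^ 5 * b ^ 6 * p = (X * b) ^ 5 * (b * p) by ring]
  generalize b * p = r at *
  rw [← hz] at *
  linear_combination (-z ^ 2) * hN

theorem etaZ_pow_three {b e : ℤ⟦X⟧} (hb : b = expandFive (expandFive (pentagonalSeries ℤ)))
    (he : e = pentagonalSeries ℤ) : etaZ ^ 3 =
    expandFive (expandFive (pentagonalSeries ℤ) * partitionSeries ^ 6) *
      ((X * b) ^ 3 * (e ^ 2 + 5 * e * (X * b))) +
      expandFive etaS * (15 + 25 * etaZ + 25 * etaZ ^ 2) := by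
  have hN := pentagonalSeries_norm
  have hq := partitionSeries_mul_pentagonalSeries
  rw [map_mul, map_pow, expandFive_etaS, etaZ, ← hb, ← he] at *
  generalize expandFive partitionSeries ^ 6 = p at *
  generalize partitionSeries = q at *
  have hz : X * b * q * e = X * b := by linear_combination X * b * hq
  generalize X * b * q = z at *
  rw [show X ^ 5 * b ^ 6 * p = (X * b) ^ 5 * (b * p) by ring]
  generalize b * p = r at *
  rw [← hz] at *
  linear_combination (-z ^ 3) * hN

theorem etaZ_pow_four {b e : ℤ⟦X⟧} (hb : b = expandFive (expandFive (pentagonalSeries ℤ)))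
    (he : e = pentagonalSeries ℤ) : etaZ ^ 4 =
    expandFive (expandFive (pentagonalSeries ℤ) * partitionSeries ^ 6) *
      ((X * b) ^ 4 * e) +
      expandFive etaS * (5 + 15 * etaZ + 25 * etaZ ^ 2 + 25 * etaZ ^ 3) := by
  have hN := pentagonalSeries_norm
  have hq := partitionSeries_mul_pentagonalSeries
  rw [map_mul, map_pow, expandFive_etaS, etaZ, ← hb, ← he] at *
  generalize expandFive partitionSeries ^ 6 = p at *
  generalize partitionSeries = q at *
  have hz : X * b * q * e = X * b := by linear_combination X * b * hq
  generalize X * b * q = z at *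
  rw [show X ^ 5 * b ^ 6 * p = (X * b) ^ 5 * (b * p) by ring]
  generalize b * p = r at *
  rw [← hz] at *
  linear_combination (-z ^ 4) * hN

theorem decimate_one : decimate 5 0 1 = 1 := by
  ext n
  simp [coeff_one]

theorem decimate_etaZ_pow_one : decimate 5 0 (etaZ ^ 1) = (5 : ℤ) • etaS := by
  obtain ⟨A, C, h, hAC⟩ := exists_dissection
  have hAC' := congrArg expandFive hAC
  rw [map_add, map_mul, map_pow, map_zero] at hAC'
  rw [decimate_etaZ_pow_of_eq_add (etaZ_pow_one rfl rfl) (c := -20)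
    (g₁ := A ^ 4 * expandFive (pentagonalSeries ℤ) +
      3 * X * expandFive (pentagonalSeries ℤ) ^ 4 * C)
    (g₂ := A ^ 3 * expandFive (pentagonalSeries ℤ) ^ 2 +
      2 * X * expandFive (pentagonalSeries ℤ) ^ 3 * C ^ 2)
    (g₃ := 2 * A ^ 2 * expandFive (pentagonalSeries ℤ) ^ 3 +
      X * expandFive (pentagonalSeries ℤ) ^ 2 * C ^ 3)
    (g₄ := 3 * A * expandFive (pentagonalSeries ℤ) ^ 4 +
      X * expandFive (pentagonalSeries ℤ) * C ^ 4)
    (by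
      rw [dissection_etaZ_pow_one h hAC']
      simp only [map_add, map_mul, map_pow, expand_X, map_ofNat]
      push_cast
      ring)]
  have : (25 : ℤ⟦X⟧) = (25 : ℤ) • 1 := by simp
  rw [this, map_smul, decimate_one, mul_smul_comm, mul_one, ← add_smul]
  norm_num

theorem decimate_etaZ_pow_two :
    decimate 5 0 (etaZ ^ 2) = (10 : ℤ) • etaS + (125 : ℤ) • etaS ^ 2 := by
  obtain ⟨A, C, h, hAC⟩ := exists_dissection
  have hAC' := congrArg expandFive hAC
  rw [map_add, map_mul, map_pow, map_zero] at hAC'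
  rw [decimate_etaZ_pow_of_eq_add (etaZ_pow_two rfl rfl) (c := -15)
    (g₁ := 5 * X * expandFive (pentagonalSeries ℤ) ^ 4 * C)
    (g₂ := A ^ 3 * expandFive (pentagonalSeries ℤ) ^ 2 +
      2 * X * expandFive (pentagonalSeries ℤ) ^ 3 * C ^ 2)
    (g₃ := 2 * A ^ 2 * expandFive (pentagonalSeries ℤ) ^ 3 +
      X * expandFive (pentagonalSeries ℤ) ^ 2 * C ^ 3)
    (g₄ := 5 * A * expandFive (pentagonalSeries ℤ) ^ 4)
    (by
      rw [dissection_etaZ_pow_two h hAC']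
      simp only [map_add, map_mul, map_pow, expand_X, map_ofNat]
      push_cast
      ring)]
  have : 25 + 25 * etaZ = (25 : ℤ) • 1 + (25 : ℤ) • etaZ ^ 1 := by simp
  rw [this, map_add, map_smul, map_smul, decimate_one, decimate_etaZ_pow_one]
  simp only [zsmul_eq_mul]
  push_cast
  ring

theorem decimate_etaZ_pow_three :
    decimate 5 0 (etaZ ^ 3) = (9 : ℤ) • etaS + etaS * ((25 : ℤ) • decimate 5 0 (etaZ ^ 1) +
      (25 : ℤ) • decimate 5 0 (etaZ ^ 2)) := by
  obtain ⟨A, C, h, hAC⟩ := exists_dissection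
  have hAC' := congrArg expandFive hAC
  rw [map_add, map_mul, map_pow, map_zero] at hAC'
  rw [decimate_etaZ_pow_of_eq_add (etaZ_pow_three rfl rfl) (c := -6)
    (g₁ := 3 * X * expandFive (pentagonalSeries ℤ) ^ 4 * C)
    (g₂ := X * expandFive (pentagonalSeries ℤ) ^ 3 * C ^ 2)
    (g₃ := A ^ 2 * expandFive (pentagonalSeries ℤ) ^ 3)
    (g₄ := 3 * A * expandFive (pentagonalSeries ℤ) ^ 4)
    (by
      rw [dissection_etaZ_pow_three h hAC']
      simp only [map_mul, map_pow, expand_X, map_ofNat]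
      push_cast
      ring)]
  have : 15 + 25 * etaZ + 25 * etaZ ^ 2 =
      (15 : ℤ) • 1 + ((25 : ℤ) • etaZ ^ 1 + (25 : ℤ) • etaZ ^ 2) := by
    simp [add_assoc]
  rw [this]
  simp only [map_add, map_smul, decimate_one]
  simp only [zsmul_eq_mul]
  push_cast
  ring

theorem decimate_etaZ_pow_four :
    decimate 5 0 (etaZ ^ 4) = (4 : ℤ) • etaS + etaS * ((15 : ℤ) • decimate 5 0 (etaZ ^ 1) +
      (25 : ℤ) • decimate 5 0 (etaZ ^ 2) + (25 : ℤ) • decimate 5 0 (etaZ ^ 3)) := by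
  obtain ⟨A, C, h, hAC⟩ := exists_dissection
  rw [decimate_etaZ_pow_of_eq_add (etaZ_pow_four rfl rfl) (c := -1)
    (g₁ := X * expandFive (pentagonalSeries ℤ) ^ 4 * C) (g₂ := 0) (g₃ := 0)
    (g₄ := A * expandFive (pentagonalSeries ℤ) ^ 4)
    (by
      rw [dissection_etaZ_pow_four h]
      simp only [map_mul, map_pow, expand_X, map_zero]
      push_cast
      ring)]
  have : 5 + 15 * etaZ + 25 * etaZ ^ 2 + 25 * etaZ ^ 3 =
      (5 : ℤ) • 1 + ((15 : ℤ) • etaZ ^ 1 + (25 : ℤ) • etaZ ^ 2 + (25 : ℤ) • etaZ ^ 3) := by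
    simp [add_assoc]
  rw [this]
  simp only [map_add, map_smul, decimate_one]
  simp only [zsmul_eq_mul]
  push_cast
  ring

end EtaQuotients

section Valuations

/-- The `ℤ`-span of the series `5 ^ v j * etaS ^ j` with `j ∈ s`. -/
noncomputable def etaSpan (s : Set ℕ) (v : ℕ → ℕ) : Submodule ℤ ℤ⟦X⟧ :=
  Submodule.span ℤ ((fun j ↦ (5 : ℤ) ^ v j • etaS ^ j) '' s)

theorem etaSpan_le {s : Set ℕ} {v : ℕ → ℕ} {N : Submodule ℤ ℤ⟦X⟧}
    (h : ∀ j ∈ s, (5 : ℤ) ^ v j • etaS ^ j ∈ N) : etaSpan s v ≤ N := by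
  rw [etaSpan, Submodule.span_le]
  rintro _ ⟨j, hj, rfl⟩
  exact h j hj

theorem smul_etaS_pow_mem {s : Set ℕ} {v : ℕ → ℕ} {j : ℕ} (hj : j ∈ s) {c : ℤ}
    (hc : 5 ^ v j ∣ c) : c • etaS ^ j ∈ etaSpan s v := by
  obtain ⟨d, rfl⟩ := hc
  rw [mul_comm, mul_smul]
  exact Submodule.smul_mem _ _ (Submodule.subset_span ⟨j, hj, rfl⟩)

theorem map_mem_of_mem_etaSpan {s : Set ℕ} {v : ℕ → ℕ} {N : Submodule ℤ ℤ⟦X⟧}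
    (φ : ℤ⟦X⟧ →ₗ[ℤ] ℤ⟦X⟧) (h : ∀ j ∈ s, (5 : ℤ) ^ v j • φ (etaS ^ j) ∈ N) {f : ℤ⟦X⟧}
    (hf : f ∈ etaSpan s v) : φ f ∈ N := by
  have : etaSpan s v ≤ N.comap φ := etaSpan_le fun j hj ↦ by
    rw [Submodule.mem_comap, map_smul]
    exact h j hj
  exact this hf

theorem smul_mem_etaSpan {s t : Set ℕ} {v w : ℕ → ℕ} {a : ℕ} {c : ℤ} (hc : 5 ^ a ∣ c)
    (h : ∀ j ∈ s, j ∈ t ∧ w j ≤ v j + a) {f : ℤ⟦X⟧} (hf : f ∈ etaSpan s v) :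
    c • f ∈ etaSpan t w := by
  refine map_mem_of_mem_etaSpan (c • LinearMap.id) (fun j hj ↦ ?_) hf
  rw [LinearMap.smul_apply, LinearMap.id_apply, ← mul_smul]
  refine smul_etaS_pow_mem (h j hj).1 ((pow_dvd_pow 5 (h j hj).2).trans ?_)
  rw [pow_add]
  exact mul_dvd_mul_left _ hc

theorem etaS_mul_mem_etaSpan {s t : Set ℕ} {v w : ℕ → ℕ}
    (h : ∀ j ∈ s, j + 1 ∈ t ∧ w (j + 1) ≤ v j) {f : ℤ⟦X⟧} (hf : f ∈ etaSpan s v) :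
    etaS * f ∈ etaSpan t w := by
  refine map_mem_of_mem_etaSpan (LinearMap.mulLeft ℤ etaS) (fun j hj ↦ ?_) hf
  rw [LinearMap.mulLeft_apply, ← pow_succ']
  exact smul_etaS_pow_mem (h j hj).1 (pow_dvd_pow 5 (h j hj).2)

theorem exists_eq_etaS_pow_mul {s t : Set ℕ} {v w : ℕ → ℕ} (m : ℕ)
    (h : ∀ j ∈ s, m ≤ j ∧ j - m ∈ t ∧ w (j - m) ≤ v j) {f : ℤ⟦X⟧} (hf : f ∈ etaSpan s v) :
    ∃ g ∈ etaSpan t w, etaS ^ m * g = f := by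
  have : etaSpan s v ≤ (etaSpan t w).map (LinearMap.mulLeft ℤ (etaS ^ m)) :=
    etaSpan_le fun j hj ↦ by
      obtain ⟨h1, h2, h3⟩ := h j hj
      refine ⟨_, smul_etaS_pow_mem h2 (pow_dvd_pow 5 h3), ?_⟩
      rw [LinearMap.mulLeft_apply, mul_smul_comm, ← pow_add, Nat.add_sub_cancel' h1]
  exact this hf

/-- The span in which the decimation of `etaZ ^ i` lies. -/
noncomputable def etaZSpan (i : ℕ) : Submodule ℤ ℤ⟦X⟧ :=
  etaSpan {j | i ≤ 5 * j} fun j ↦ (5 * j - i - 1) / 2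

theorem smul_etaS_mem_etaZSpan {i m : ℕ} {c : ℤ} (him : i ≤ 5 * m)
    (hc : 5 ^ ((5 * m - i - 1) / 2) ∣ c) : c • etaS ^ m ∈ etaZSpan i :=
  smul_etaS_pow_mem (s := {j | i ≤ 5 * j}) (v := fun j ↦ (5 * j - i - 1) / 2) him hc

theorem etaS_mul_smul_mem_etaZSpan {i k a : ℕ} {c : ℤ} (hc : 5 ^ a ∣ c) (hk : k ≤ 5)
    (ha : 5 ≤ 2 * a + k) {f : ℤ⟦X⟧} (hf : f ∈ etaZSpan i) :
    etaS * (c • f) ∈ etaZSpan (i + k) := by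
  refine etaS_mul_mem_etaSpan (v := fun j ↦ (5 * j - i - 1) / 2 + a) ?_
    (smul_mem_etaSpan (t := {j | i ≤ 5 * j}) hc (fun j hj ↦ ⟨hj, le_rfl⟩) hf)
  intro j hj
  rw [Set.mem_ofPred_eq] at *
  omega

theorem decimate_etaZ_pow_mem (i : ℕ) : decimate 5 0 (etaZ ^ i) ∈ etaZSpan i := by
  induction i using Nat.strong_induction_on with
  | _ i ih =>
    rcases lt_or_ge i 5 with h | h
    · interval_cases i
      · rw [pow_zero, decimate_one]
        simpa using smul_etaS_mem_etaZSpan (i := 0) (m := 0) (c := 1) (by norm_num) (by norm_num)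
      · rw [decimate_etaZ_pow_one]
        simpa using smul_etaS_mem_etaZSpan (i := 1) (m := 1) (c := 5) (by norm_num) (by norm_num)
      · rw [decimate_etaZ_pow_two]
        refine add_mem ?_ (smul_etaS_mem_etaZSpan (by norm_num) (by norm_num))
        simpa using smul_etaS_mem_etaZSpan (i := 2) (m := 1) (c := 10) (by norm_num) (by norm_num)
      · rw [decimate_etaZ_pow_three, mul_add]
        refine add_mem ?_ (add_mem
          (etaS_mul_smul_mem_etaZSpan (k := 2) (a := 2) ?_ ?_ ?_ (ih 1 (by norm_num)))
          (etaS_mul_smul_mem_etaZSpan (k := 1) (a := 2) ?_ ?_ ?_ (ih 2 (by norm_num)))) <;>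
          try norm_num
        simpa using smul_etaS_mem_etaZSpan (i := 3) (m := 1) (c := 9) (by norm_num) (by norm_num)
      · rw [decimate_etaZ_pow_four, mul_add, mul_add]
        refine add_mem ?_ (add_mem (add_mem
          (etaS_mul_smul_mem_etaZSpan (k := 3) (a := 1) ?_ ?_ ?_ (ih 1 (by norm_num)))
          (etaS_mul_smul_mem_etaZSpan (k := 2) (a := 2) ?_ ?_ ?_ (ih 2 (by norm_num))))
          (etaS_mul_smul_mem_etaZSpan (k := 1) (a := 2) ?_ ?_ ?_ (ih 3 (by norm_num)))) <;>
          try norm_num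
        simpa using smul_etaS_mem_etaZSpan (i := 4) (m := 1) (c := 4) (by norm_num) (by norm_num)
    · obtain ⟨i, rfl⟩ := Nat.exists_eq_add_of_le' h
      rw [etaZ_pow_add_five, mul_add, mul_add, mul_add, mul_add]
      have h0 := etaS_mul_smul_mem_etaZSpan (k := 5) (a := 0) (c := 1) (by norm_num) (by norm_num)
        (by norm_num) (ih i (by omega))
      rw [one_smul] at h0
      exact add_mem (add_mem (add_mem (add_mem h0
        (etaS_mul_smul_mem_etaZSpan (k := 4) (a := 1) (by norm_num) (by norm_num) (by norm_num)
          (ih (i + 1) (by omega))))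
        (etaS_mul_smul_mem_etaZSpan (k := 3) (a := 1) (by norm_num) (by norm_num) (by norm_num)
          (ih (i + 2) (by omega))))
        (etaS_mul_smul_mem_etaZSpan (k := 2) (a := 2) (by norm_num) (by norm_num) (by norm_num)
          (ih (i + 3) (by omega))))
        (etaS_mul_smul_mem_etaZSpan (k := 1) (a := 2) (by norm_num) (by norm_num) (by norm_num)
          (ih (i + 4) (by omega)))

theorem decimate_etaZ_pow_mul_etaS_pow_mem (c j : ℕ) :
    decimate 5 0 (etaZ ^ c * etaS ^ j) ∈ etaZSpan (j + c) := by
  have h1 : etaS ^ j * decimate 5 0 (etaZ ^ c * etaS ^ j) = decimate 5 0 (etaZ ^ (6 * j + c)) := by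
    rw [← decimate_five_mul _ _ (by norm_num), pow_add, pow_mul, ← expandFive_etaS_mul_etaS,
      map_pow]
    congr 1
    ring
  obtain ⟨g, hg, h2⟩ := exists_eq_etaS_pow_mul (t := {l | j + c ≤ 5 * l})
    (w := fun l ↦ (5 * l - (j + c) - 1) / 2) j
    (fun l hl ↦ by rw [Set.mem_ofPred_eq] at *; omega) (decimate_etaZ_pow_mem (6 * j + c))
  rw [← h2] at h1
  rw [mul_left_cancel₀ (pow_ne_zero _ etaS_ne_zero) h1]
  exact hg

theorem decimate_etaZ_pow_mul_mem {s t : Set ℕ} {v w : ℕ → ℕ} (c : ℕ)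
    (h : ∀ j ∈ s, ∀ l, j + c ≤ 5 * l → l ∈ t ∧ w l ≤ (5 * l - (j + c) - 1) / 2 + v j)
    {f : ℤ⟦X⟧} (hf : f ∈ etaSpan s v) : decimate 5 0 (etaZ ^ c * f) ∈ etaSpan t w :=
  map_mem_of_mem_etaSpan (decimate 5 0 ∘ₗ LinearMap.mulLeft ℤ (etaZ ^ c))
    (fun j hj ↦ smul_mem_etaSpan dvd_rfl (h j hj) (decimate_etaZ_pow_mul_etaS_pow_mem c j)) hf

end Valuations

section Iteration

/-- The shape of the decimated generating functions after an odd number of steps. -/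
def IsOddStage (c e : ℕ) (f : ℤ⟦X⟧) : Prop :=
  ∃ G ∈ etaSpan {i | 1 ≤ i} (fun i ↦ e + (5 * i - 5) / 2),
    X * f = expandFive partitionSeries ^ c * G

/-- The shape of the decimated generating functions after an even number of steps. -/
def IsEvenStage (c e : ℕ) (f : ℤ⟦X⟧) : Prop :=
  ∃ G ∈ etaSpan {j | 1 ≤ j} (fun j ↦ e + (5 * j - 4) / 2), X * f = partitionSeries ^ c * G

theorem IsOddStage.decimate {c e : ℕ} {f : ℤ⟦X⟧} (h : IsOddStage c e f) :
    IsEvenStage c (e + 1) (decimate 5 4 f) := by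
  obtain ⟨G, hG, hf⟩ := h
  refine ⟨_root_.decimate 5 0 (etaZ ^ 0 * G), decimate_etaZ_pow_mul_mem 0 ?_ hG, ?_⟩
  · intro j hj l hl
    rw [Set.mem_ofPred_eq] at *
    have : j = 1 ∨ 2 ≤ j := by omega
    rcases this with rfl | h <;> omega
  · rw [← decimate_X_pow_mul (M := 5) (s := 1) (by norm_num) (by norm_num), pow_one, hf,
      ← map_pow, decimate_five_mul _ _ (by norm_num), pow_zero, one_mul]

theorem X_mul_partitionSeries :
    X * partitionSeries = etaZ * expandFive (expandFive partitionSeries) := by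
  have h := congrArg expandFive expandFive_partitionSeries_mul
  rw [map_mul, map_one] at h
  rw [etaZ]
  linear_combination (-(X * partitionSeries)) * h

theorem decimate_of_X_mul_eq {c r : ℕ} {f G : ℤ⟦X⟧} (hc : 0 < c) (hr : r + (c + 1) = 5)
    (hf : X * f = partitionSeries ^ c * G) :
    X * decimate 5 r f = expandFive partitionSeries ^ c * decimate 5 0 (etaZ ^ c * G) := by
  rw [← decimate_X_pow_mul hr (by omega), pow_succ, mul_assoc, hf, ← mul_assoc, ← mul_pow,
    X_mul_partitionSeries, mul_pow, mul_comm (etaZ ^ c), mul_assoc, ← map_pow,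
    decimate_five_mul _ _ (by norm_num)]

theorem IsEvenStage.decimate_one {e : ℕ} {f : ℤ⟦X⟧} (h : IsEvenStage 1 e f) :
    IsOddStage 1 (e + 1) (decimate 5 3 f) := by
  obtain ⟨G, hG, hf⟩ := h
  refine ⟨_, decimate_etaZ_pow_mul_mem 1 ?_ hG,
    decimate_of_X_mul_eq (by norm_num) (by norm_num) hf⟩
  intro j hj l hl
  rw [Set.mem_ofPred_eq] at *
  omega

theorem IsEvenStage.decimate_two {e : ℕ} {f : ℤ⟦X⟧} (h : IsEvenStage 2 e f) :
    IsOddStage 2 e (decimate 5 2 f) := by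
  obtain ⟨G, hG, hf⟩ := h
  refine ⟨_, decimate_etaZ_pow_mul_mem 2 ?_ hG,
    decimate_of_X_mul_eq (by norm_num) (by norm_num) hf⟩
  intro j hj l hl
  rw [Set.mem_ofPred_eq] at *
  omega

theorem isOddStage_partitionSeries : IsOddStage 1 1 (decimate 5 4 partitionSeries) := by
  refine ⟨(5 : ℤ) • etaS ^ 1, smul_etaS_pow_mem (by simp) (by norm_num), ?_⟩
  rw [← decimate_X_pow_mul (M := 5) (s := 1) (by norm_num) (by norm_num), pow_one,
    X_mul_partitionSeries, mul_comm, decimate_five_mul _ _ (by norm_num), pow_one, pow_one,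
    ← decimate_etaZ_pow_one, pow_one]

theorem IsOddStage.mul {e : ℕ} {f : ℤ⟦X⟧} (h : IsOddStage 1 e f) :
    IsOddStage 2 e (f * expandFive partitionSeries) := by
  obtain ⟨G, hG, hf⟩ := h
  refine ⟨G, hG, ?_⟩
  rw [← mul_assoc, hf]
  ring

theorem IsOddStage.dvd_coeff {c e : ℕ} {f : ℤ⟦X⟧} (h : IsOddStage c e f) (n : ℕ) :
    5 ^ e ∣ coeff n f := by
  obtain ⟨G, hG, hf⟩ := h
  have hG' : ((5 ^ e : ℤ) : ℤ⟦X⟧) ∣ G := by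
    have : etaSpan {i | 1 ≤ i} (fun i ↦ e + (5 * i - 5) / 2) ≤
        (Ideal.span {((5 ^ e : ℤ) : ℤ⟦X⟧)}).restrictScalars ℤ := etaSpan_le fun j _ ↦ by
      rw [Submodule.restrictScalars_mem, Ideal.mem_span_singleton, pow_add, mul_smul, zsmul_eq_mul]
      exact dvd_mul_right _ _
    exact Ideal.mem_span_singleton.1 (this hG)
  obtain ⟨H, rfl⟩ := hG'
  rw [← coeff_succ_X_mul, hf, mul_left_comm, ← zsmul_eq_mul, map_zsmul, smul_eq_mul]
  exact dvd_mul_right _ _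

theorem exists_isOddStage_partitionSeries (k : ℕ) : ∃ δ < 5 ^ (2 * k + 1),
    24 * δ = 19 * 5 ^ (2 * k + 1) + 1 ∧
      IsOddStage 1 (2 * k + 1) (decimate (5 ^ (2 * k + 1)) δ partitionSeries) := by
  induction k with
  | zero => exact ⟨4, by norm_num, by norm_num, isOddStage_partitionSeries⟩
  | succ k ih =>
    obtain ⟨δ, hlt, hδ, h⟩ := ih
    have h' := h.decimate.decimate_one
    rw [decimate_decimate, decimate_decimate] at h'
    have hp : (5 : ℕ) ^ (2 * (k + 1) + 1) = 5 ^ (2 * k + 1) * (5 * 5) := by ring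
    refine ⟨5 ^ (2 * k + 1) * (5 * 3 + 4) + δ, ?_, ?_, ?_⟩
    · omega
    · omega
    · rw [hp]
      exact h'

theorem exists_isOddStage_twoColor (k β : ℕ) : ∃ δ,
    24 * δ = 14 * 5 ^ (2 * k + 1 + 2 * β) + 5 ^ (2 * k + 2) + 1 ∧
      IsOddStage 2 (2 * k + 1 + β) (decimate (5 ^ (2 * k + 1 + 2 * β)) δ
        (partitionSeries * expand (5 ^ (2 * k + 2)) (by positivity) partitionSeries)) := by
  induction β with
  | zero =>
    obtain ⟨δ, hlt, hδ, h⟩ := exists_isOddStage_partitionSeries k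
    refine ⟨δ, ?_, ?_⟩
    · rw [hδ]
      ring
    · have he : expand (5 ^ (2 * k + 2)) (by positivity) partitionSeries =
          expand (5 ^ (2 * k + 1)) (by positivity) (expandFive partitionSeries) :=
        expand_mul (5 ^ (2 * k + 1)) (by positivity) 5 (by norm_num) partitionSeries
      rw [he]
      have := h.mul
      rw [← decimate_mul_expand (by positivity) hlt] at this
      exact this
  | succ β ih =>
    obtain ⟨δ, hδ, h⟩ := ih
    have h' := h.decimate.decimate_two
    rw [decimate_decimate, decimate_decimate] at h'
    have hp : (5 : ℕ) ^ (2 * k + 1 + 2 * (β + 1)) = 5 ^ (2 * k + 1 + 2 * β) * (5 * 5) := by ring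
    refine ⟨5 ^ (2 * k + 1 + 2 * β) * (5 * 2 + 4) + δ, ?_, ?_⟩
    · omega
    · rw [hp]
      exact h'

theorem coeff_partitionSeries_mul_expand (ℓ : ℕ) (hℓ : ℓ ≠ 0) (n : ℕ) :
    coeff n (partitionSeries * expand ℓ hℓ partitionSeries) = p1 ℓ n := by
  rw [← mk_card_partition_dvd, coeff_mul, Finset.Nat.sum_antidiagonal_eq_sum_range_succ_mk, p1]
  simp [partitionSeries]

end Iteration

/-- For all `n, β ≥ 0` and `k ≥ 1`, `24` divides `14·5^{2k+2β-1} + 5^{2k} + 1` and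
`p_{1,5^{2k}}(5^{2k+2β-1} n + (14·5^{2k+2β-1} + 5^{2k} + 1)/24) ≡ 0 (mod 5^{2k+β-1})`. -/
theorem twoColorCongruence_even_a (n β k : ℕ) (hk : 1 ≤ k) :
    24 ∣ 14 * 5 ^ (2 * k + 2 * β - 1) + 5 ^ (2 * k) + 1 ∧
      5 ^ (2 * k + β - 1) ∣
        p1 (5 ^ (2 * k))
          (5 ^ (2 * k + 2 * β - 1) * n +
            (14 * 5 ^ (2 * k + 2 * β - 1) + 5 ^ (2 * k) + 1) / 24) := by
  obtain ⟨k, rfl⟩ := Nat.exists_eq_add_of_le' hk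
  obtain ⟨δ, hδ, h⟩ := exists_isOddStage_twoColor k β
  rw [show 2 * (k + 1) + 2 * β - 1 = 2 * k + 1 + 2 * β by omega,
    show 2 * (k + 1) + β - 1 = 2 * k + 1 + β by omega, show 2 * (k + 1) = 2 * k + 2 by ring,
    ← hδ, Nat.mul_div_cancel_left _ (by norm_num)]
  refine ⟨dvd_mul_right _ _, ?_⟩
  have := h.dvd_coeff n
  rw [coeff_decimate, coeff_partitionSeries_mul_expand] at this
  exact_mod_cast this
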